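/- Let d : U → U → ℝ be a metric distance on a finite set U, g a non-negative monotone submodular set function on U, D the sum-sum diversity of d, and f = g + D. Let k ≥ 10 and let x_1,…,x_k be a greedy sequence for f on T ⊆ U with S_k = {x_1,…,x_k}. Then for every t ∈ T ∖ S_k: Σ_{i=1}^{k} d(t,x_i) ≤ (4.5/(k−1))·f(S_k). -/

import Mathlib

open Finset

/-- Sum-sum diversity: the sum of `d u v` over all unordered pairs of distinct
elements of `S` (each unordered pair counted once). -/
noncomputable def sumsumDiv {α : Type*} [DecidableEq α] (d : α → α → ℝ) (S : Finset α) : ℝ :=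
  (∑ p ∈ S.offDiag, d p.1 p.2) / 2

/-- The prefix set `{x 0, …, x (i-1)}` of a sequence `x`. -/
def preSet {α : Type*} [DecidableEq α] {k : ℕ} (x : Fin k → α) (i : ℕ) : Finset α :=
  (Finset.univ.filter fun j : Fin k => (j : ℕ) < i).image x

/-- `x 0, …, x (k-1)` is a greedy sequence for `f = g + D` on `T`: its members are
distinct elements of `T` and each one maximizes the marginal gain
`Δ(u, S_{i-1}) + ∑_{j < i} d (x j) u` over all `u ∈ T ∖ S_{i-1}`. -/
def IsGreedySeq {α : Type*} [DecidableEq α] (g : Finset α → ℝ) (d : α → α → ℝ)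
    (T : Finset α) {k : ℕ} (x : Fin k → α) : Prop :=
  Function.Injective x ∧ (∀ j, x j ∈ T) ∧
    ∀ i : Fin k, ∀ u ∈ T \ preSet x (i : ℕ),
      (g (insert u (preSet x (i : ℕ))) - g (preSet x (i : ℕ)))
          + ∑ j ∈ Finset.univ.filter (fun j : Fin k => (j : ℕ) < (i : ℕ)), d (x j) u
        ≤ (g (insert (x i) (preSet x (i : ℕ))) - g (preSet x (i : ℕ)))
          + ∑ j ∈ Finset.univ.filter (fun j : Fin k => (j : ℕ) < (i : ℕ)), d (x j) (x i)

theorem sumsumDiv_insert {α : Type*} [DecidableEq α] {d : α → α → ℝ}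
    (hdsymm : ∀ u v, d u v = d v u) {S : Finset α} {a : α} (ha : a ∉ S) :
    sumsumDiv d (insert a S) = sumsumDiv d S + ∑ s ∈ S, d s a := by
  have hdisj₁ : Disjoint S.offDiag ({a} ×ˢ S) := by
    rw [Finset.disjoint_left]
    rintro ⟨u, v⟩ h₁ h₂
    simp only [mem_offDiag, mem_product, mem_singleton] at h₁ h₂
    exact ha (h₂.1 ▸ h₁.1)
  have hdisj₂ : Disjoint (S.offDiag ∪ {a} ×ˢ S) (S ×ˢ {a}) := by
    rw [Finset.disjoint_left]
    rintro ⟨u, v⟩ h₁ h₂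
    simp only [mem_union, mem_offDiag, mem_product, mem_singleton] at h₁ h₂
    rcases h₁ with h | h
    · exact ha (h₂.2 ▸ h.2.1)
    · exact ha (h₂.2 ▸ h.2)
  have hswap : ∑ s ∈ S, d a s = ∑ s ∈ S, d s a := sum_congr rfl fun s _ => hdsymm a s
  rw [sumsumDiv, sumsumDiv, offDiag_insert ha, sum_union hdisj₂, sum_union hdisj₁,
    sum_product, sum_product]
  simp only [sum_singleton, hswap]
  ring

theorem preSet_zero {α : Type*} [DecidableEq α] {k : ℕ} (x : Fin k → α) :
    preSet x 0 = ∅ := by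
  simp [preSet]

theorem preSet_succ {α : Type*} [DecidableEq α] {k : ℕ} (x : Fin k → α) {n : ℕ} (hn : n < k) :
    preSet x (n + 1) = insert (x ⟨n, hn⟩) (preSet x n) := by
  rw [preSet, preSet, ← image_insert]
  congr 1
  ext j
  simp only [mem_filter, mem_univ, true_and, mem_insert, Fin.ext_iff]
  omega

theorem preSet_self {α : Type*} [DecidableEq α] {k : ℕ} (x : Fin k → α) :
    preSet x k = univ.image x := by
  simp [preSet]

theorem preSet_subset {α : Type*} [DecidableEq α] {k : ℕ} (x : Fin k → α) (n : ℕ) :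
    preSet x n ⊆ univ.image x :=
  image_subset_image (filter_subset _ _)

theorem sum_preSet {α : Type*} [DecidableEq α] {k : ℕ} {x : Fin k → α}
    (hx : Function.Injective x) (n : ℕ) (φ : α → ℝ) :
    ∑ s ∈ preSet x n, φ s = ∑ j ∈ univ.filter (fun j : Fin k => (j : ℕ) < n), φ (x j) :=
  sum_image hx.injOn

theorem notMem_preSet {α : Type*} [DecidableEq α] {k : ℕ} {x : Fin k → α}
    (hx : Function.Injective x) (i : Fin k) : x i ∉ preSet x i := by
  simp only [preSet, mem_image, mem_filter, mem_univ, true_and, not_exists, not_and]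
  intro j hj h
  exact hj.ne (congrArg Fin.val (hx h))

theorem card_preSet {α : Type*} [DecidableEq α] {k : ℕ} {x : Fin k → α}
    (hx : Function.Injective x) {n : ℕ} (hn : n ≤ k) : (preSet x n).card = n := by
  induction n with
  | zero => simp [preSet_zero]
  | succ n ih =>
    rw [preSet_succ x hn, card_insert_of_notMem (notMem_preSet hx ⟨n, hn⟩), ih (by omega)]

/-- Every prefix of a greedy sequence satisfies the bound with the constant `3`; neither
submodularity of `g` nor a lower bound on the length is needed. -/
theorem IsGreedySeq.sum_dist_le {α : Type*} [DecidableEq α] {d : α → α → ℝ}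
    (hdsymm : ∀ u v, d u v = d v u) (hdtri : ∀ u v w, d u w ≤ d u v + d v w)
    {g : Finset α → ℝ} (hgnn : ∀ S : Finset α, 0 ≤ g S)
    (hgmono : ∀ A B : Finset α, A ⊆ B → g A ≤ g B)
    {k : ℕ} {T : Finset α} {x : Fin k → α} (hx : IsGreedySeq g d T x)
    {t : α} (htT : t ∈ T) (htx : t ∉ univ.image x) {n : ℕ} (hn : n ≤ k) :
    ((n : ℝ) - 1) * ∑ s ∈ preSet x n, d t s
      ≤ 3 * (g (preSet x n) + sumsumDiv d (preSet x n)) := by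
  obtain ⟨hinj, -, hgreedy⟩ := hx
  induction n with
  | zero => simpa [preSet_zero, sumsumDiv] using hgnn ∅
  | succ n ih =>
    have hnk : n < k := hn
    have ih := ih hnk.le
    have hnot := notMem_preSet hinj ⟨n, hnk⟩
    have hgain := hgreedy ⟨n, hnk⟩ t
      (mem_sdiff.2 ⟨htT, fun h => htx (preSet_subset x n h)⟩)
    rw [← sum_preSet hinj n (fun s => d s t),
      ← sum_preSet hinj n (fun s => d s (x ⟨n, hnk⟩))] at hgain
    have hgt := hgmono _ _ (subset_insert t (preSet x n))
    have hgx := hgmono _ _ (subset_insert (x ⟨n, hnk⟩) (preSet x n))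
    have hswap : ∑ s ∈ preSet x n, d s t = ∑ s ∈ preSet x n, d t s :=
      sum_congr rfl fun s _ => hdsymm s t
    have htri : (n : ℝ) * d t (x ⟨n, hnk⟩)
        ≤ ∑ s ∈ preSet x n, d t s + ∑ s ∈ preSet x n, d s (x ⟨n, hnk⟩) := by
      rw [← sum_add_distrib]
      calc (n : ℝ) * d t (x ⟨n, hnk⟩) = ∑ _s ∈ preSet x n, d t (x ⟨n, hnk⟩) := by
            rw [sum_const, card_preSet hinj hnk.le, nsmul_eq_mul]
        _ ≤ _ := sum_le_sum fun s _ => hdtri t s _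
    rw [preSet_succ x hnk, sumsumDiv_insert hdsymm hnot, sum_insert hnot]
    push_cast
    dsimp only at hgain
    linarith

/-- if `k ≥ 10` and `x 1, …, x k` is a greedy sequence for `f = g + D` on
`T ⊆ U` with `S_k = {x 1, …, x k}`, then for every `t ∈ T ∖ S_k`,
`∑_{i=1}^{k} d(t, x i) ≤ (4.5/(k−1))·f(S_k)`. -/
theorem stmt7 {α : Type*} [Fintype α] [DecidableEq α]
    (d : α → α → ℝ)
    (hd0 : ∀ u, d u u = 0) (hdnn : ∀ u v, 0 ≤ d u v)
    (hdsymm : ∀ u v, d u v = d v u)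
    (hdtri : ∀ u v w, d u w ≤ d u v + d v w)
    (g : Finset α → ℝ)
    (hgnn : ∀ S : Finset α, 0 ≤ g S)
    (hgmono : ∀ A B : Finset α, A ⊆ B → g A ≤ g B)
    (hgsub : ∀ A B : Finset α, A ⊆ B → ∀ y ∉ B,
      g (insert y B) - g B ≤ g (insert y A) - g A)
    (k : ℕ) (hk : 10 ≤ k) (T : Finset α) (x : Fin k → α) (hx : IsGreedySeq g d T x)
    (t : α) (htT : t ∈ T) (htx : t ∉ Finset.univ.image x) :
    ∑ j : Fin k, d t (x j)
      ≤ 4.5 / ((k : ℝ) - 1)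
          * (g (Finset.univ.image x) + sumsumDiv d (Finset.univ.image x)) := by
  have hbound := hx.sum_dist_le hdsymm hdtri hgnn hgmono htT htx le_rfl
  rw [preSet_self, sum_image hx.1.injOn] at hbound
  have hk1 : (0 : ℝ) < (k : ℝ) - 1 := by
    have : (10 : ℝ) ≤ k := by exact_mod_cast hk
    linarith
  have hD : 0 ≤ sumsumDiv d (Finset.univ.image x) :=
    div_nonneg (sum_nonneg fun p _ => hdnn p.1 p.2) zero_le_two
  have hg := hgnn (Finset.univ.image x)
  rw [div_mul_eq_mul_div, le_div_iff₀ hk1]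
  linarith
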